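/- arXiv:1503.04213 — 3 statements merged into one kernel-verified Lean document; each statement's English description precedes it below -/
import Mathlib

section
/- For any density matrices ρ, σ on ℂ^d and α ∈ [0,1], the eigenvalue vector of ρ ⊞_α σ := α ρ + (1−α) σ − √(α(1−α)) i[ρ,σ] is majorized by α λ(ρ) + (1−α) λ(σ), where λ(·) denotes the vector of eigenvalues arranged in non-increasing order. -/
open Matrix
open scoped ComplexOrder

/-- The partial swap addition rule `ρ ⊞_α σ`. -/
noncomputable def boxplus {d : ℕ} (α : ℝ) (ρ σ : Matrix (Fin d) (Fin d) ℂ) :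
    Matrix (Fin d) (Fin d) ℂ :=
  (α : ℂ) • ρ + ((1 - α : ℝ) : ℂ) • σ
    - ((Real.sqrt (α * (1 - α)) : ℂ) * Complex.I) • (ρ * σ - σ * ρ)

/-- The entries of `u` rearranged in non-increasing order. -/
noncomputable def sortedDesc {d : ℕ} (u : Fin d → ℝ) : Fin d → ℝ :=
  fun i => u (Tuple.sort u i.rev)

/-- Majorization `u ≺ v`: all partial sums of the largest `k` entries of `u` are bounded
by those of `v`, with equality for the total sums. -/
def Majorizes {d : ℕ} (u v : Fin d → ℝ) : Prop :=
  (∀ k : ℕ, ∑ i ∈ Finset.univ.filter (fun i : Fin d => (i : ℕ) < k), sortedDesc u i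
      ≤ ∑ i ∈ Finset.univ.filter (fun i : Fin d => (i : ℕ) < k), sortedDesc v i)
    ∧ ∑ i, u i = ∑ i, v i


/-- Abel summation: nonpositive partial sums against antitone nonnegative weights. -/
theorem sum_mul_nonpos_of_antitone : ∀ {d : ℕ} (p c : Fin d → ℝ), Antitone p → (∀ i, 0 ≤ p i) →
    (∀ m : ℕ, ∑ i ∈ Finset.univ.filter (fun i : Fin d => (i : ℕ) < m), c i ≤ 0) →
    ∑ i, p i * c i ≤ 0
  | 0, _, _, _, _, _ => by simp
  | d + 1, p, c, hp, hp0, hc => by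
    have ih := sum_mul_nonpos_of_antitone (fun i : Fin d => p i.castSucc - p (Fin.last d))
      (fun i => c i.castSucc)
      (fun i j hij => sub_le_sub_right (hp (Fin.castSucc_le_castSucc_iff.2 hij)) _)
      (fun i => sub_nonneg.2 (hp (Fin.le_last _)))
      (fun m => by
        have h := hc (min m d)
        rw [Finset.sum_filter, Fin.sum_univ_castSucc] at h
        rw [Finset.sum_filter]
        simpa using h)
    have hall : ∑ i, c i ≤ 0 := by
      have h := hc (d + 1)
      rwa [Finset.filter_true_of_mem (fun i _ => i.isLt)] at h
    have h1 : p (Fin.last d) * ∑ i, c i ≤ 0 :=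
      mul_nonpos_of_nonneg_of_nonpos (hp0 _) hall
    rw [Fin.sum_univ_castSucc] at h1 ⊢
    simp only [sub_mul, Finset.sum_sub_distrib, ← Finset.mul_sum] at ih
    linarith

theorem sortedDesc_antitone {d : ℕ} (u : Fin d → ℝ) : Antitone (sortedDesc u) :=
  fun _ _ hij => Tuple.monotone_sort u (Fin.rev_le_rev.2 hij)

theorem sortedDesc_of_antitone {d : ℕ} {u : Fin d → ℝ} (hu : Antitone u) : sortedDesc u = u := by
  have h : u ∘ (Fin.revPerm : Equiv.Perm (Fin d)) = u ∘ Tuple.sort u :=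
    Tuple.comp_sort_eq_comp_iff_monotone.2 fun i j hij => hu (Fin.rev_le_rev.2 hij)
  funext i
  have := congrFun h i.rev
  simpa [sortedDesc] using this.symm

theorem sum_sortedDesc {d : ℕ} (u : Fin d → ℝ) : ∑ i, sortedDesc u i = ∑ i, u i :=
  Equiv.sum_comp ((Fin.revPerm : Equiv.Perm (Fin d)).trans (Tuple.sort u)) u

theorem sum_eigenvalues_eq_re_trace {d : ℕ} {A : Matrix (Fin d) (Fin d) ℂ} (hA : A.IsHermitian) :
    ∑ i, hA.eigenvalues i = A.trace.re := by
  simp [hA.trace_eq_sum_eigenvalues]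

/-- Spectral decomposition into rank-one projections ordered by decreasing eigenvalue. -/
theorem exists_spectral_projections {d : ℕ} {A : Matrix (Fin d) (Fin d) ℂ} (hA : A.IsHermitian) :
    ∃ E : Fin d → Matrix (Fin d) (Fin d) ℂ, (∀ i, (E i).IsHermitian) ∧
      (∀ i j, E i * E j = if i = j then E i else 0) ∧ (∀ i, (E i).trace = 1) ∧
      A = ∑ i, ((sortedDesc hA.eigenvalues i : ℝ) : ℂ) • E i := by
  set π : Equiv.Perm (Fin d) := (Fin.revPerm : Equiv.Perm (Fin d)).trans
    (Tuple.sort hA.eigenvalues) with hπ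
  set U : Matrix (Fin d) (Fin d) ℂ := (hA.eigenvectorUnitary).1 with hU
  have hUU : Uᴴ * U = 1 := Unitary.coe_star_mul_self hA.eigenvectorUnitary
  refine ⟨fun i => U * Matrix.single (π i) (π i) 1 * Uᴴ, ?_, ?_, ?_, ?_⟩
  · intro i
    simp [Matrix.IsHermitian, Matrix.conjTranspose_mul, Matrix.mul_assoc]
  · intro i j
    have h : U * Matrix.single (π i) (π i) 1 * Uᴴ * (U * Matrix.single (π j) (π j) 1 * Uᴴ) =
        U * (Matrix.single (π i) (π i) 1 * (Uᴴ * U) * Matrix.single (π j) (π j) 1) * Uᴴ := by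
      noncomm_ring
    rw [h, hUU, mul_one]
    split_ifs with hij
    · subst hij; simp
    · rw [Matrix.single_mul_single_of_ne _ _ _ _ (fun h => hij (π.injective h))]; simp
  · intro i
    rw [Matrix.trace_mul_cycle, hUU, one_mul, Matrix.trace_single_eq_same]
  · have hdiag : Matrix.diagonal (fun i => (hA.eigenvalues i : ℂ)) =
        ∑ i, (hA.eigenvalues i : ℂ) • Matrix.single i i (1 : ℂ) := by
      ext a b
      simp [Matrix.sum_apply, Matrix.diagonal_apply, Matrix.single_apply, ite_and]
    have hs : A = U * Matrix.diagonal (fun i => (hA.eigenvalues i : ℂ)) * Uᴴ := by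
      exact hA.spectral_theorem
    rw [hdiag, ← Equiv.sum_comp π, Matrix.mul_sum, Matrix.sum_mul] at hs
    refine hs.trans (Finset.sum_congr rfl fun i _ => ?_)
    rw [Matrix.mul_smul, Matrix.smul_mul]
    rfl

theorem partialSum_isHermitian {d : ℕ} {E : Fin d → Matrix (Fin d) (Fin d) ℂ}
    (hE : ∀ i, (E i).IsHermitian) (S : Finset (Fin d)) : (∑ i ∈ S, E i).IsHermitian := by
  simp only [Matrix.IsHermitian, Matrix.conjTranspose_sum, fun i => (hE i).eq]

theorem partialSum_idempotent {d : ℕ} {E : Fin d → Matrix (Fin d) (Fin d) ℂ}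
    (hE : ∀ i j, E i * E j = if i = j then E i else 0) (S : Finset (Fin d)) :
    (∑ i ∈ S, E i) * (∑ i ∈ S, E i) = ∑ i ∈ S, E i := by
  rw [Finset.sum_mul]
  refine Finset.sum_congr rfl fun i hi => ?_
  simp [Finset.mul_sum, hE, hi]

theorem re_trace_conjTranspose_mul_self_nonneg {d : ℕ} (A : Matrix (Fin d) (Fin d) ℂ) :
    0 ≤ ((Aᴴ * A).trace).re :=
  (Complex.nonneg_iff.1 (Matrix.posSemidef_conjTranspose_mul_self A).trace_nonneg).1

theorem re_trace_antiHermitian_le {d : ℕ} (a b : ℝ) (A B : Matrix (Fin d) (Fin d) ℂ) :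
    a * b * (Complex.I * (Aᴴ * B - Bᴴ * A).trace).re ≤
      a ^ 2 * ((Aᴴ * A).trace).re + b ^ 2 * ((Bᴴ * B).trace).re := by
  have h := re_trace_conjTranspose_mul_self_nonneg ((a : ℂ) • A - (b * Complex.I) • B)
  simp only [Matrix.conjTranspose_sub, Matrix.conjTranspose_smul, Matrix.sub_mul, Matrix.mul_sub,
    Matrix.smul_mul, Matrix.mul_smul, Matrix.trace_sub, Matrix.trace_smul, smul_eq_mul] at h ⊢
  simp at h ⊢
  nlinarith

section Projections

variable {d : ℕ} {P Q R : Matrix (Fin d) (Fin d) ℂ}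

theorem commutator_bound_outside (hP : P.IsHermitian) (hPP : P * P = P) (hQ : Q.IsHermitian)
    (hQQ : Q * Q = Q) (hR : R.IsHermitian) (hRR : R * R = R) (a b : ℝ) :
    a * b * (Complex.I * (R * (P * Q - Q * P)).trace).re ≤
      a ^ 2 * (P.trace - (R * P).trace).re + b ^ 2 * (Q.trace - (R * Q).trace).re := by
  have h := re_trace_antiHermitian_le a (-b) (P * (1 - R)) (Q * (1 - R))
  have hS : (1 - R) * (1 - R) = 1 - R := by simp [sub_mul, mul_sub, hRR]
  have key : ∀ X Y : Matrix (Fin d) (Fin d) ℂ, X.IsHermitian →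
      ((X * (1 - R))ᴴ * (Y * (1 - R))).trace = (X * Y).trace - (R * (X * Y)).trace := by
    intro X Y hX
    rw [Matrix.conjTranspose_mul, hX.eq, Matrix.conjTranspose_sub, Matrix.conjTranspose_one, hR.eq,
      show (1 - R) * X * (Y * (1 - R)) = (1 - R) * (X * Y) * (1 - R) by noncomm_ring,
      Matrix.trace_mul_cycle, hS, sub_mul, one_mul, Matrix.trace_sub]
  rw [Matrix.trace_sub, key P Q hP, key Q P hQ, key P P hP, key Q Q hQ, hPP, hQQ,
    Matrix.trace_mul_comm P Q] at h
  rw [mul_sub, Matrix.trace_sub]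
  convert h using 1
  · simp; ring
  · ring

theorem commutator_bound_inside (hP : P.IsHermitian) (hPP : P * P = P) (hQ : Q.IsHermitian)
    (hQQ : Q * Q = Q) (hR : R.IsHermitian) (hRR : R * R = R) (a b : ℝ) :
    a * b * (Complex.I * (R * (P * Q - Q * P)).trace).re ≤
      a ^ 2 * (R.trace - (R * P).trace).re + b ^ 2 * (R.trace - (R * Q).trace).re := by
  have compl : ∀ {X : Matrix (Fin d) (Fin d) ℂ}, X * X = X → (1 - X) * (1 - X) = 1 - X :=
    fun h => by simp [sub_mul, mul_sub, h]
  have h := commutator_bound_outside (Matrix.isHermitian_one.sub hP) (compl hPP)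
    (Matrix.isHermitian_one.sub hQ) (compl hQQ) (Matrix.isHermitian_one.sub hR) (compl hRR) a (-b)
  have e1 : (1 - P) * (1 - Q) - (1 - Q) * (1 - P) = P * Q - Q * P := by noncomm_ring
  have e2 : (P * Q - Q * P).trace = 0 := by
    rw [Matrix.trace_sub, Matrix.trace_mul_comm, sub_self]
  rw [e1] at h
  simp only [sub_mul (1 : Matrix (Fin d) (Fin d) ℂ) R, one_mul, mul_sub R 1, mul_one,
    Matrix.trace_sub (P * Q - Q * P), e2, Matrix.trace_sub (1 - P), Matrix.trace_sub (1 - Q),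
    Matrix.trace_sub R] at h
  convert h using 1
  · simp
  · simp

theorem commutator_bound_mixed (hP : P.IsHermitian) (hPP : P * P = P) (hQ : Q.IsHermitian)
    (hQQ : Q * Q = Q) (hR : R.IsHermitian) (hRR : R * R = R) (a b : ℝ) :
    a * b * (Complex.I * (R * (P * Q - Q * P)).trace).re ≤
      a ^ 2 * (P.trace - (R * P).trace).re + b ^ 2 * (R.trace - (R * Q).trace).re := by
  set S := 1 - R with hS
  set W := 1 - Q with hW
  have hSS : S * S = S := by simp [hS, sub_mul, mul_sub, hRR]
  have hWW : W * W = W := by simp [hW, sub_mul, mul_sub, hQQ]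
  have hSh : Sᴴ = S := (Matrix.isHermitian_one.sub hR).eq
  have hWh : Wᴴ = W := (Matrix.isHermitian_one.sub hQ).eq
  have h := re_trace_antiHermitian_le a (-b) (S * P) (W * R * P)
  have hpos := re_trace_conjTranspose_mul_self_nonneg (W * R * (1 - P))
  have hPc : (1 - P) * (1 - P) = 1 - P := by simp [sub_mul, mul_sub, hPP]
  have t1 : ((S * P)ᴴ * (S * P)).trace = P.trace - (R * P).trace := by
    rw [Matrix.conjTranspose_mul, hSh, hP.eq,
      show P * S * (S * P) = P * (S * S) * P by noncomm_ring, hSS, Matrix.trace_mul_cycle, hPP,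
      Matrix.trace_mul_comm, hS, sub_mul, one_mul, Matrix.trace_sub]
  have t2 : ∀ X : Matrix (Fin d) (Fin d) ℂ, X.IsHermitian → X * X = X →
      ((W * R * X)ᴴ * (W * R * X)).trace = (X * (R * W * R)).trace := by
    intro X hX hXX
    rw [Matrix.conjTranspose_mul, Matrix.conjTranspose_mul, hX.eq, hWh, hR.eq,
      show X * (R * W) * (W * R * X) = X * (R * (W * W) * R) * X by noncomm_ring, hWW,
      Matrix.trace_mul_cycle, hXX]
  have t3 : (R * W * R).trace = R.trace - (R * Q).trace := by
    rw [Matrix.trace_mul_cycle, hRR, hW, mul_sub, mul_one, Matrix.trace_sub]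
  have t4 : ((S * P)ᴴ * (W * R * P) - (W * R * P)ᴴ * (S * P)).trace =
      -(R * (P * Q - Q * P)).trace := by
    simp only [Matrix.conjTranspose_mul, hSh, hWh, hP.eq, hR.eq]
    rw [Matrix.trace_sub,
      show P * S * (W * R * P) = P * (S * W * R) * P by noncomm_ring,
      show P * (R * W) * (S * P) = P * (R * W * S) * P by noncomm_ring,
      Matrix.trace_mul_cycle, hPP, Matrix.trace_mul_cycle P _ P, hPP, ← Matrix.trace_sub,
      show P * (S * W * R) - P * (R * W * S) = (P * R) * Q - P * (Q * R) by
        rw [hS, hW]; noncomm_ring,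
      Matrix.trace_sub, mul_sub, Matrix.trace_sub, Matrix.mul_assoc P R Q, Matrix.trace_mul_comm P,
      Matrix.mul_assoc R Q P, ← Matrix.mul_assoc P Q R, Matrix.trace_mul_comm (P * Q) R, neg_sub]
  rw [t2 _ (Matrix.isHermitian_one.sub hP) hPc, sub_mul, one_mul, Matrix.trace_sub, t3] at hpos
  rw [t1, t2 P hP hPP, t4] at h
  have : b ^ 2 * ((P * (R * W * R)).trace).re ≤ b ^ 2 * (R.trace - (R * Q).trace).re := by
    refine mul_le_mul_of_nonneg_left ?_ (sq_nonneg b)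
    rw [Complex.sub_re] at hpos
    linarith
  have e : a * -b * (Complex.I * -(R * (P * Q - Q * P)).trace).re =
      a * b * (Complex.I * (R * (P * Q - Q * P)).trace).re := by
    rw [mul_neg Complex.I, Complex.neg_re]; ring
  rw [e] at h
  nlinarith

theorem projection_block_bound (hP : P.IsHermitian) (hPP : P * P = P) (hQ : Q.IsHermitian)
    (hQQ : Q * Q = Q) (hR : R.IsHermitian) (hRR : R * R = R) {α : ℝ} (hα : α ∈ Set.Icc (0 : ℝ) 1)
    {m n k x y : ℝ} (hm : 1 ≤ m) (hn : 1 ≤ n) (hPm : P.trace = m) (hQn : Q.trace = n)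
    (hRk : R.trace = k) (hx : x = m ∨ x = k) (hy : y = n ∨ y = k) :
    α * n * (R * P).trace.re + (1 - α) * m * (R * Q).trace.re
      - √(α * (1 - α)) * (Complex.I * (R * (P * Q - Q * P)).trace).re ≤
      α * n * x + (1 - α) * m * y := by
  have hα0 : 0 ≤ α := hα.1
  have hα1 : 0 ≤ 1 - α := sub_nonneg.2 hα.2
  have hs : √(α * (1 - α)) = √α * √(1 - α) := Real.sqrt_mul hα0 _
  have hmixed' : ∀ a b : ℝ, a * b * (Complex.I * (R * (P * Q - Q * P)).trace).re ≤
      a ^ 2 * (R.trace - (R * P).trace).re + b ^ 2 * (Q.trace - (R * Q).trace).re := by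
    intro a b
    have h := commutator_bound_mixed hQ hQQ hP hPP hR hRR (-b) a
    rw [← neg_sub (P * Q), mul_neg, Matrix.trace_neg, mul_neg, Complex.neg_re] at h
    linarith
  have key : ∀ a b : ℝ, a * b * (Complex.I * (R * (P * Q - Q * P)).trace).re ≤
      a ^ 2 * (x - (R * P).trace.re) + b ^ 2 * (y - (R * Q).trace.re) := by
    intro a b
    rcases hx with rfl | rfl <;> rcases hy with rfl | rfl
    · simpa [hPm, hQn] using commutator_bound_outside hP hPP hQ hQQ hR hRR a b
    · simpa [hPm, hRk] using commutator_bound_mixed hP hPP hQ hQQ hR hRR a b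
    · simpa [hQn, hRk] using hmixed' a b
    · simpa [hRk] using commutator_bound_inside hP hPP hQ hQQ hR hRR a b
  have hx0 : 0 ≤ x - (R * P).trace.re := by simpa using key 1 0
  have hy0 : 0 ≤ y - (R * Q).trace.re := by simpa using key 0 1
  have h := key (√α) (-√(1 - α))
  rw [neg_sq, Real.sq_sqrt hα0, Real.sq_sqrt hα1] at h
  have h1 := mul_nonneg (mul_nonneg hα0 hx0) (sub_nonneg.2 hn)
  have h2 := mul_nonneg (mul_nonneg hα1 hy0) (sub_nonneg.2 hm)
  rw [hs]
  linarith

end Projections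

theorem card_filter_lt_or {d : ℕ} (m k : ℕ) :
    (((Finset.univ.filter (fun i : Fin d => (i : ℕ) < m)).filter (fun i : Fin d => (i : ℕ) < k)).card =
        (Finset.univ.filter (fun i : Fin d => (i : ℕ) < m)).card) ∨
      (((Finset.univ.filter (fun i : Fin d => (i : ℕ) < m)).filter (fun i : Fin d => (i : ℕ) < k)).card =
        (Finset.univ.filter (fun i : Fin d => (i : ℕ) < k)).card) := by
  rcases le_total m k with h | h
  · left
    rw [Finset.filter_true_of_mem]
    intro i hi
    exact (Finset.mem_filter.1 hi).2.trans_le h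
  · right
    congr 1
    ext i
    simp only [Finset.mem_filter, Finset.mem_univ, true_and]
    omega

theorem re_trace_mul_sum_smul {d : ℕ} (R : Matrix (Fin d) (Fin d) ℂ) (S : Finset (Fin d))
    (p : Fin d → ℝ) (E : Fin d → Matrix (Fin d) (Fin d) ℂ) :
    (R * ∑ i ∈ S, (p i : ℂ) • E i).trace.re = ∑ i ∈ S, p i * (R * E i).trace.re := by
  simp [Finset.mul_sum, Matrix.trace_sum]

theorem re_trace_mul_commutator_sum_smul {d : ℕ} (R : Matrix (Fin d) (Fin d) ℂ)
    (S T : Finset (Fin d)) (p q : Fin d → ℝ) (E F : Fin d → Matrix (Fin d) (Fin d) ℂ) :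
    (Complex.I * (R * ((∑ i ∈ S, (p i : ℂ) • E i) * (∑ j ∈ T, (q j : ℂ) • F j) -
        (∑ j ∈ T, (q j : ℂ) • F j) * (∑ i ∈ S, (p i : ℂ) • E i))).trace).re =
      ∑ i ∈ S, ∑ j ∈ T, p i * (q j * (Complex.I * (R * (E i * F j - F j * E i)).trace).re) := by
  rw [Finset.sum_mul_sum, Finset.sum_mul_sum, Finset.sum_comm (s := T), ← Finset.sum_sub_distrib]
  simp only [← Finset.sum_sub_distrib, Finset.mul_sum, Matrix.trace_sum, Complex.re_sum]
  refine Finset.sum_congr rfl fun i _ => Finset.sum_congr rfl fun j _ => ?_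
  rw [smul_mul_smul_comm, smul_mul_smul_comm, mul_comm (q j : ℂ), ← smul_sub, Matrix.mul_smul,
    Matrix.trace_smul, smul_eq_mul, mul_left_comm, ← Complex.ofReal_mul, Complex.re_ofReal_mul,
    mul_assoc]

theorem stmt_6 (d : ℕ) (α : ℝ) (hα : α ∈ Set.Icc (0:ℝ) 1)
    (ρ σ : Matrix (Fin d) (Fin d) ℂ)
    (hρ : ρ.PosSemidef) (hρtr : ρ.trace = 1)
    (hσ : σ.PosSemidef) (hσtr : σ.trace = 1)
    (hH : (boxplus α ρ σ).IsHermitian) :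
    Majorizes hH.eigenvalues
      (fun i => α * sortedDesc hρ.1.eigenvalues i + (1 - α) * sortedDesc hσ.1.eigenvalues i) := by
  obtain ⟨E, hEh, hEE, hEt, hE⟩ := exists_spectral_projections hρ.1
  obtain ⟨F, hFh, hFF, hFt, hF⟩ := exists_spectral_projections hσ.1
  obtain ⟨G, hGh, hGG, hGt, hG⟩ := exists_spectral_projections hH
  have hpa := sortedDesc_antitone hρ.1.eigenvalues
  have hqa := sortedDesc_antitone hσ.1.eigenvalues
  have hp0 : ∀ i, 0 ≤ sortedDesc hρ.1.eigenvalues i := fun i => hρ.eigenvalues_nonneg _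
  have hq0 : ∀ i, 0 ≤ sortedDesc hσ.1.eigenvalues i := fun i => hσ.eigenvalues_nonneg _
  have hp1 : ∑ i, sortedDesc hρ.1.eigenvalues i = 1 := by
    rw [sum_sortedDesc, sum_eigenvalues_eq_re_trace, hρtr, Complex.one_re]
  have hq1 : ∑ i, sortedDesc hσ.1.eigenvalues i = 1 := by
    rw [sum_sortedDesc, sum_eigenvalues_eq_re_trace, hσtr, Complex.one_re]
  generalize sortedDesc hρ.1.eigenvalues = p at *
  generalize sortedDesc hσ.1.eigenvalues = q at *
  have hα0 : 0 ≤ α := hα.1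
  have hα1 : 0 ≤ 1 - α := sub_nonneg.2 hα.2
  refine ⟨fun k => ?_, ?_⟩
  · rw [sortedDesc_of_antitone (u := fun i => α * p i + (1 - α) * q i) fun i j hij =>
      add_le_add (mul_le_mul_of_nonneg_left (hpa hij) hα0)
        (mul_le_mul_of_nonneg_left (hqa hij) hα1)]
    set K := Finset.univ.filter (fun i : Fin d => (i : ℕ) < k) with hK
    set R := ∑ i ∈ K, G i with hR
    have hsum : ∑ i ∈ K, sortedDesc hH.eigenvalues i = (R * boxplus α ρ σ).trace.re := by
      conv_rhs => rw [hG]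
      rw [re_trace_mul_sum_smul]
      simp only [hR, Finset.sum_mul, hGG, Finset.sum_ite_eq']
      simp [apply_ite Matrix.trace, hGt, apply_ite Complex.re]
    set x : Fin d → ℝ := fun i => (R * E i).trace.re with hx
    set y : Fin d → ℝ := fun i => (R * F i).trace.re with hy
    set z : Fin d → Fin d → ℝ :=
      fun i j => (Complex.I * (R * (E i * F j - F j * E i)).trace).re with hz
    set s := √(α * (1 - α)) with hs
    have hbox : (R * boxplus α ρ σ).trace.re =
        α * ∑ i, p i * x i + (1 - α) * ∑ j, q j * y j - s * ∑ i, ∑ j, p i * (q j * z i j) := by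
      have h1 := re_trace_mul_sum_smul R Finset.univ p E
      have h2 := re_trace_mul_sum_smul R Finset.univ q F
      have h3 := re_trace_mul_commutator_sum_smul R Finset.univ Finset.univ p q E F
      rw [← hE] at h1
      rw [← hF] at h2
      rw [← hE, ← hF] at h3
      rw [← h1, ← h2, ← h3, boxplus, mul_sub, mul_add, Matrix.trace_sub, Matrix.trace_add,
        Matrix.mul_smul, Matrix.mul_smul, Matrix.mul_smul, Matrix.trace_smul, Matrix.trace_smul,
        Matrix.trace_smul, smul_eq_mul, smul_eq_mul, smul_eq_mul, Complex.sub_re, Complex.add_re,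
        mul_assoc, Complex.re_ofReal_mul, Complex.re_ofReal_mul, Complex.re_ofReal_mul]
    -- The defect is bilinear in the spectra, so it suffices to bound it on initial segments.
    set c : Fin d → Fin d → ℝ := fun i j =>
      α * (x i - if (i : ℕ) < k then 1 else 0) + (1 - α) * (y j - if (j : ℕ) < k then 1 else 0)
        - s * z i j with hc
    have hblock : ∀ m n : ℕ, ∑ i ∈ Finset.univ.filter (fun i : Fin d => (i : ℕ) < m),
        ∑ j ∈ Finset.univ.filter (fun j : Fin d => (j : ℕ) < n), c i j ≤ 0 := by
      intro m n
      have hxm := card_filter_lt_or (d := d) m k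
      have hyn := card_filter_lt_or (d := d) n k
      set S := Finset.univ.filter (fun i : Fin d => (i : ℕ) < m) with hS
      set T := Finset.univ.filter (fun i : Fin d => (i : ℕ) < n) with hT
      rcases S.eq_empty_or_nonempty with h0 | hS0
      · simp [h0]
      rcases T.eq_empty_or_nonempty with h0 | hT0
      · simp [h0]
      have h := projection_block_bound (partialSum_isHermitian hEh S) (partialSum_idempotent hEE S)
        (partialSum_isHermitian hFh T) (partialSum_idempotent hFF T)
        (partialSum_isHermitian hGh K) (partialSum_idempotent hGG K) hα
        (m := S.card) (n := T.card) (k := K.card)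
        (x := (S.filter (fun i : Fin d => (i : ℕ) < k)).card) (y := (T.filter (fun i : Fin d => (i : ℕ) < k)).card)
        (by exact_mod_cast hS0.card_pos) (by exact_mod_cast hT0.card_pos)
        (by simp [Matrix.trace_sum, hEt]) (by simp [Matrix.trace_sum, hFt])
        (by simp [Matrix.trace_sum, hGt]) (by exact_mod_cast hxm) (by exact_mod_cast hyn)
      have h1 := re_trace_mul_sum_smul R S 1 E
      have h2 := re_trace_mul_sum_smul R T 1 F
      have h3 := re_trace_mul_commutator_sum_smul R S T 1 1 E F
      simp only [Pi.one_apply, Complex.ofReal_one, one_smul, one_mul] at h1 h2 h3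
      rw [← hR, h1, h2, h3] at h
      simp only [hc, hx, hy, hz, hs, Finset.sum_sub_distrib, Finset.sum_add_distrib, ← Finset.mul_sum,
        Finset.sum_const, nsmul_eq_mul, Finset.sum_boole]
      linarith
    have hle : ∑ i, p i * ∑ j, q j * c i j ≤ 0 := by
      refine sum_mul_nonpos_of_antitone p _ hpa hp0 fun m => ?_
      rw [Finset.sum_comm]
      simp only [← Finset.mul_sum]
      refine sum_mul_nonpos_of_antitone q _ hqa hq0 fun n => ?_
      rw [Finset.sum_comm]
      exact hblock m n
    have hexp : ∑ i, p i * ∑ j, q j * c i j =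
        α * (∑ i, p i * x i - ∑ i ∈ K, p i) + (1 - α) * (∑ j, q j * y j - ∑ j ∈ K, q j)
          - s * ∑ i, ∑ j, p i * (q j * z i j) := by
      have e1 : ∀ i, ∑ j, q j * c i j = α * (x i - if (i : ℕ) < k then 1 else 0)
          + (1 - α) * (∑ j, q j * y j - ∑ j ∈ K, q j) - s * ∑ j, q j * z i j := by
        intro i
        have e : ∀ j, q j * c i j = q j * (α * (x i - if (i : ℕ) < k then 1 else 0))
            + (1 - α) * (q j * y j - if (j : ℕ) < k then q j else 0) - s * (q j * z i j) := by
          intro j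
          simp only [hc]
          split_ifs <;> ring
        simp only [e, Finset.sum_sub_distrib, Finset.sum_add_distrib, ← Finset.mul_sum,
          ← Finset.sum_mul, hq1, one_mul, hK, Finset.sum_filter]
      have e2 : ∀ i, p i * ∑ j, q j * c i j = α * (p i * x i - if (i : ℕ) < k then p i else 0)
          + p i * ((1 - α) * (∑ j, q j * y j - ∑ j ∈ K, q j))
          - s * (p i * ∑ j, q j * z i j) := by
        intro i
        rw [e1]
        split_ifs <;> ring
      simp only [e2, Finset.sum_sub_distrib, Finset.sum_add_distrib, ← Finset.mul_sum,
        ← Finset.sum_mul, hp1, one_mul, hK, Finset.sum_filter]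
    rw [hsum, hbox, Finset.sum_add_distrib, ← Finset.mul_sum, ← Finset.mul_sum]
    linarith
  · have ht : (boxplus α ρ σ).trace = 1 := by
      simp [boxplus, Matrix.trace_sub, Matrix.trace_add, Matrix.trace_smul, hρtr, hσtr,
        Matrix.trace_mul_comm ρ σ]
    rw [sum_eigenvalues_eq_re_trace, ht, Finset.sum_add_distrib, ← Finset.mul_sum,
      ← Finset.mul_sum, hp1, hq1, Complex.one_re]
    ring
end

section
/- For any density matrices ρ, σ on ℂ^d and α ∈ [0,1], the von Neumann entropy satisfies H(ρ ⊞_α σ) ≥ α H(ρ) + (1−α) H(σ), where ρ ⊞_α σ = α ρ + (1−α) σ − √(α(1−α)) i[ρ,σ]. -/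
open Matrix
open scoped ComplexOrder

open scoped Classical in
/-- The von Neumann entropy `H(ρ) = -Tr (ρ log ρ)`, in terms of the eigenvalues of `ρ`
(natural logarithm). -/
noncomputable def vnEntropy {d : ℕ} (ρ : Matrix (Fin d) (Fin d) ℂ) : ℝ :=
  if h : ρ.IsHermitian then ∑ i, Real.negMulLog (h.eigenvalues i) else 0

section SwapSum

variable {n : Type*} [Fintype n]

/-- The matrix `x² A + y² B - i x y [A, B]`; it is `boxplus` parametrised by square roots of the
weights. -/
noncomputable def swapSum (x y : ℝ) (A B : Matrix n n ℂ) : Matrix n n ℂ :=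
  ((x : ℂ) ^ 2) • A + ((y : ℂ) ^ 2) • B - ((x : ℂ) * y * Complex.I) • (A * B - B * A)

theorem swapSum_comm (x y : ℝ) (A B : Matrix n n ℂ) :
    swapSum x y A B = swapSum y (-x) B A := by
  simp only [swapSum, Complex.ofReal_neg]
  rw [← neg_sub (B * A) (A * B)]
  module

theorem re_trace_swapSum (x y : ℝ) (A B : Matrix n n ℂ) :
    (swapSum x y A B).trace.re = x ^ 2 * A.trace.re + y ^ 2 * B.trace.re := by
  simp [swapSum, trace_mul_comm A B, ← Complex.ofReal_pow]

theorem swapSum_one_sub [DecidableEq n] {x y : ℝ} (hxy : x ^ 2 + y ^ 2 = 1) (A B : Matrix n n ℂ) :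
    1 - swapSum x y A B = swapSum x (-y) (1 - A) (1 - B) := by
  have hxy' : (y : ℂ) ^ 2 = 1 - (x : ℂ) ^ 2 := by
    rw [eq_sub_iff_add_eq, add_comm]; exact_mod_cast hxy
  have h : (1 - A) * (1 - B) - (1 - B) * (1 - A) = A * B - B * A := by noncomm_ring
  simp only [swapSum, Complex.ofReal_neg, h, neg_sq, hxy']
  module

/-- A Hermitian matrix whose spectrum lies in `[0, 1]`, expressed by `A² ≤ A`. -/
structure IsEffect (A : Matrix n n ℂ) : Prop where
  isHermitian : A.IsHermitian
  sub_sq : (A - A * A).PosSemidef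

theorem IsEffect.one_sub [DecidableEq n] {A : Matrix n n ℂ} (hA : IsEffect A) :
    IsEffect (1 - A) where
  isHermitian := Matrix.isHermitian_one.sub hA.isHermitian
  sub_sq := by
    convert hA.sub_sq using 1
    noncomm_ring

theorem IsEffect.swapSum_posSemidef {A B : Matrix n n ℂ} (hA : IsEffect A) (hB : IsEffect B)
    (x y : ℝ) : (swapSum x y A B).PosSemidef := by
  have hsq := Matrix.posSemidef_conjTranspose_mul_self
    ((x : ℂ) • A - ((y : ℂ) * Complex.I) • B)
  have hx : (0 : ℂ) ≤ (x : ℂ) ^ 2 := by exact_mod_cast sq_nonneg x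
  have hy : (0 : ℂ) ≤ (y : ℂ) ^ 2 := by exact_mod_cast sq_nonneg y
  convert hsq.add ((hA.sub_sq.smul hx).add (hB.sub_sq.smul hy)) using 1
  have hI : (y : ℂ) * Complex.I * (y * Complex.I) = - (y : ℂ) ^ 2 := by
    linear_combination (y : ℂ) ^ 2 * Complex.I_mul_I
  simp only [swapSum, conjTranspose_sub, conjTranspose_smul, hA.isHermitian.eq, hB.isHermitian.eq,
    Complex.star_def, map_mul, Complex.conj_ofReal, Complex.conj_I, mul_sub, sub_mul,
    smul_mul_assoc, mul_smul_comm, smul_sub, smul_smul, mul_neg, hI]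
  module

theorem re_trace_nonneg {A : Matrix n n ℂ} (hA : A.PosSemidef) : 0 ≤ A.trace.re :=
  (Complex.le_def.1 hA.trace_nonneg).1

theorem trace_compression {Q : Matrix n n ℂ} (hQ : Q * Q = Q) (X : Matrix n n ℂ) :
    (Q * X * Q).trace = (Q * X).trace := by
  rw [trace_mul_comm, ← mul_assoc, hQ]

theorem re_trace_proj_mul_nonneg {Q T : Matrix n n ℂ} (hQ : Q.IsHermitian) (hQQ : Q * Q = Q)
    (hT : T.PosSemidef) : 0 ≤ (Q * T).trace.re := by
  have h := re_trace_nonneg (hT.mul_mul_conjTranspose_same Q)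
  rwa [hQ.eq, trace_compression hQQ] at h

variable [DecidableEq n]

theorem one_sub_mul_self {Q : Matrix n n ℂ} (hQQ : Q * Q = Q) : (1 - Q) * (1 - Q) = 1 - Q := by
  rw [mul_sub, sub_mul, sub_mul, hQQ]; simp

theorem IsEffect.re_trace_proj_mul_swapSum_le_traces {A B Q : Matrix n n ℂ} (hA : IsEffect A)
    (hB : IsEffect B) (hQ : Q.IsHermitian) (hQQ : Q * Q = Q) (x y : ℝ) :
    (Q * swapSum x y A B).trace.re ≤ x ^ 2 * A.trace.re + y ^ 2 * B.trace.re := by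
  have h := re_trace_proj_mul_nonneg (Matrix.isHermitian_one.sub hQ) (one_sub_mul_self hQQ)
    (hA.swapSum_posSemidef hB x y)
  rw [sub_mul, one_mul, trace_sub, Complex.sub_re, re_trace_swapSum] at h
  linarith

theorem IsEffect.re_trace_proj_mul_swapSum_le_rank {A B Q : Matrix n n ℂ} (hA : IsEffect A)
    (hB : IsEffect B) (hQ : Q.IsHermitian) (hQQ : Q * Q = Q) {x y : ℝ} (hxy : x ^ 2 + y ^ 2 = 1) :
    (Q * swapSum x y A B).trace.re ≤ Q.trace.re := by
  have h := re_trace_proj_mul_nonneg hQ hQQ (hA.one_sub.swapSum_posSemidef hB.one_sub x (-y))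
  rw [← swapSum_one_sub hxy, mul_sub, mul_one, trace_sub, Complex.sub_re] at h
  linarith

theorem trace_compression_split {Q : Matrix n n ℂ} (hQQ : Q * Q = Q) (X Y : Matrix n n ℂ) :
    (Q * X * (1 - Q) * ((1 - Q) * Y * Q)).trace = (Q * X * Y).trace - (Q * X * Q * Y).trace := by
  have h : Q * X * (1 - Q) * ((1 - Q) * Y * Q) = Q * (X * ((1 - Q) * (1 - Q)) * Y) * Q := by
    noncomm_ring
  rw [h, trace_compression hQQ, one_sub_mul_self hQQ, ← trace_sub]
  congr 1
  noncomm_ring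

theorem IsEffect.re_trace_proj_mul_swapSum_le_left {A B Q : Matrix n n ℂ} (hA : IsEffect A)
    (hB : IsEffect B) (hQ : Q.IsHermitian) (hQQ : Q * Q = Q) (x y : ℝ) :
    (Q * swapSum x y A B).trace.re ≤ x ^ 2 * A.trace.re + y ^ 2 * Q.trace.re := by
  obtain ⟨G, rfl⟩ : ∃ G, B = 1 - G := ⟨1 - B, by simp⟩
  have hG : IsEffect G := by simpa using hB.one_sub
  have hQ' := Matrix.isHermitian_one.sub hQ
  have hQQ' := one_sub_mul_self hQQ
  have hAsq := re_trace_proj_mul_nonneg hQ' hQQ' hA.sub_sq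
  have hGsq := re_trace_proj_mul_nonneg hQ hQQ hG.sub_sq
  have hcorner := re_trace_nonneg (Matrix.posSemidef_self_mul_conjTranspose
    ((1 - Q) * A * (1 - Q)))
  have hcorner' := re_trace_nonneg (Matrix.posSemidef_self_mul_conjTranspose (Q * G * Q))
  have hoff := re_trace_nonneg (Matrix.posSemidef_self_mul_conjTranspose
    ((x : ℂ) • (Q * A * (1 - Q)) + ((y : ℂ) * Complex.I) • (Q * G * (1 - Q))))
  have hcyc : (Q * G * Q * A).trace = (Q * A * Q * G).trace := by
    rw [mul_assoc, trace_mul_comm, ← mul_assoc]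
  have e1 : ((1 - Q) * A * (1 - Q) * ((1 - Q) * (A * (1 - Q)))).trace
      = (A * A).trace - 2 * (Q * A * A).trace + (Q * A * Q * A).trace := by
    have h : (1 - Q) * A * (1 - Q) * ((1 - Q) * (A * (1 - Q)))
        = (1 - Q) * (A * ((1 - Q) * (1 - Q)) * A) * (1 - Q) := by noncomm_ring
    rw [h, trace_compression hQQ', hQQ']
    have h2 : (1 - Q) * (A * (1 - Q) * A) = A * A - Q * A * A - A * Q * A + Q * A * Q * A := by
      noncomm_ring
    have h3 : (A * Q * A).trace = (Q * A * A).trace := by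
      rw [mul_assoc, trace_mul_comm]
    rw [h2, trace_add, trace_sub, trace_sub, h3]
    ring
  have e2 : (Q * G * Q * (Q * (G * Q))).trace = (Q * G * Q * G).trace := by
    have h : Q * G * Q * (Q * (G * Q)) = Q * (G * (Q * Q) * G) * Q := by noncomm_ring
    rw [h, trace_compression hQQ, hQQ]
    congr 1
    noncomm_ring
  simp only [conjTranspose_mul, conjTranspose_add, conjTranspose_smul, hQ.eq, hQ'.eq,
    hA.isHermitian.eq, hG.isHermitian.eq, Complex.star_def, map_mul, Complex.conj_ofReal,
    Complex.conj_I] at hcorner hcorner' hoff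
  rw [e1] at hcorner
  rw [e2] at hcorner'
  simp only [← mul_assoc (1 - Q) A Q, ← mul_assoc (1 - Q) G Q, mul_add, add_mul, smul_mul_assoc,
    mul_smul_comm, trace_add, trace_smul, trace_compression_split hQQ, hcyc] at hoff
  have htr : Q * swapSum x y A (1 - G) = ((x : ℂ) ^ 2) • (Q * A) + ((y : ℂ) ^ 2) • (Q - Q * G)
      + ((x : ℂ) * y * Complex.I) • (Q * A * G - Q * G * A) := by
    simp only [swapSum, mul_add, mul_sub, sub_mul, mul_smul_comm, mul_one, one_mul, ← mul_assoc]
    module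
  rw [htr]
  simp only [mul_sub, sub_mul, one_mul, ← mul_assoc, trace_sub, Complex.sub_re] at hAsq hGsq
  simp [← Complex.ofReal_pow, trace_sub] at hcorner hcorner' hoff ⊢
  linarith [mul_nonneg (sq_nonneg x) hAsq, mul_nonneg (sq_nonneg y) hGsq,
    mul_nonneg (sq_nonneg x) hcorner, mul_nonneg (sq_nonneg y) hcorner']

theorem IsEffect.re_trace_proj_mul_swapSum_le_right {A B Q : Matrix n n ℂ} (hA : IsEffect A)
    (hB : IsEffect B) (hQ : Q.IsHermitian) (hQQ : Q * Q = Q) (x y : ℝ) :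
    (Q * swapSum x y A B).trace.re ≤ x ^ 2 * Q.trace.re + y ^ 2 * B.trace.re := by
  have h := hB.re_trace_proj_mul_swapSum_le_left hA hQ hQQ y (-x)
  rw [swapSum_comm]
  linarith

end SwapSum

section SpectralFun

variable {n : Type*} [Fintype n] [DecidableEq n]

/-- The matrix with the eigenvectors of the Hermitian matrix `A` and with prescribed eigenvalues. -/
noncomputable def Matrix.IsHermitian.withEigenvalues {A : Matrix n n ℂ} (hA : A.IsHermitian)
    (g : n → ℝ) : Matrix n n ℂ :=
  (hA.eigenvectorUnitary : Matrix n n ℂ) * diagonal (fun i => (g i : ℂ)) *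
    (hA.eigenvectorUnitary : Matrix n n ℂ)ᴴ

namespace Matrix.IsHermitian

variable {A : Matrix n n ℂ} (hA : A.IsHermitian)

theorem withEigenvalues_eigenvalues : hA.withEigenvalues hA.eigenvalues = A := by
  conv_rhs => rw [hA.spectral_theorem, Unitary.conjStarAlgAut_apply]
  rfl

theorem withEigenvalues_add (f g : n → ℝ) :
    hA.withEigenvalues (f + g) = hA.withEigenvalues f + hA.withEigenvalues g := by
  simp only [withEigenvalues, ← add_mul, ← mul_add, diagonal_add, Pi.add_apply, Complex.ofReal_add]

theorem withEigenvalues_sub (f g : n → ℝ) :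
    hA.withEigenvalues (f - g) = hA.withEigenvalues f - hA.withEigenvalues g := by
  simp only [withEigenvalues, ← sub_mul, ← mul_sub, diagonal_sub, Pi.sub_apply, Complex.ofReal_sub]

theorem withEigenvalues_smul (c : ℝ) (g : n → ℝ) :
    hA.withEigenvalues (c • g) = (c : ℂ) • hA.withEigenvalues g := by
  have h : diagonal (fun i => ((c • g) i : ℂ)) = (c : ℂ) • diagonal (fun i => (g i : ℂ)) := by
    rw [← diagonal_smul]; congr 1; ext i; simp
  simp only [withEigenvalues, h, mul_smul_comm, smul_mul_assoc]

theorem withEigenvalues_mul (f g : n → ℝ) :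
    hA.withEigenvalues f * hA.withEigenvalues g = hA.withEigenvalues (f * g) := by
  have hU : (hA.eigenvectorUnitary : Matrix n n ℂ)ᴴ * (hA.eigenvectorUnitary : Matrix n n ℂ) = 1 :=
    Unitary.coe_star_mul_self hA.eigenvectorUnitary
  have h : diagonal (fun i => ((f * g) i : ℂ))
      = diagonal (fun i => (f i : ℂ)) * diagonal (fun i => (g i : ℂ)) := by
    rw [diagonal_mul_diagonal]; congr 1; ext i; simp
  simp only [withEigenvalues, h]
  simp only [mul_assoc]
  rw [← mul_assoc (hA.eigenvectorUnitary : Matrix n n ℂ)ᴴ, hU, one_mul]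

theorem trace_withEigenvalues (g : n → ℝ) :
    (hA.withEigenvalues g).trace.re = ∑ i, g i := by
  have hU : (hA.eigenvectorUnitary : Matrix n n ℂ)ᴴ * (hA.eigenvectorUnitary : Matrix n n ℂ) = 1 :=
    Unitary.coe_star_mul_self hA.eigenvectorUnitary
  rw [withEigenvalues, trace_mul_comm, ← mul_assoc, hU, one_mul, trace_diagonal]
  simp

theorem isHermitian_withEigenvalues (g : n → ℝ) : (hA.withEigenvalues g).IsHermitian := by
  refine isHermitian_mul_mul_conjTranspose _ (isHermitian_diagonal_of_self_adjoint _ ?_)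
  ext i
  simp

theorem posSemidef_withEigenvalues {g : n → ℝ} (hg : ∀ i, 0 ≤ g i) :
    (hA.withEigenvalues g).PosSemidef :=
  (PosSemidef.diagonal fun i => by simpa using hg i).mul_mul_conjTranspose_same _

theorem isEffect_withEigenvalues {g : n → ℝ} (hg0 : ∀ i, 0 ≤ g i) (hg1 : ∀ i, g i ≤ 1) :
    IsEffect (hA.withEigenvalues g) where
  isHermitian := hA.isHermitian_withEigenvalues g
  sub_sq := by
    rw [withEigenvalues_mul, ← withEigenvalues_sub]
    refine hA.posSemidef_withEigenvalues fun i => ?_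
    simp only [Pi.sub_apply, Pi.mul_apply]
    nlinarith [hg0 i, hg1 i]

/-- Splitting a Hermitian matrix with spectrum in `[0, 1]` at the level `s`. -/
theorem exists_effect_decomposition (h0 : ∀ i, 0 ≤ hA.eigenvalues i)
    (h1 : ∀ i, hA.eigenvalues i ≤ 1) {s : ℝ} (hs0 : 0 < s) (hs1 : s < 1) :
    ∃ L U : Matrix n n ℂ, IsEffect L ∧ IsEffect U ∧ A = (s : ℂ) • L + ((1 - s : ℝ) : ℂ) • U ∧
      (1 - s) * U.trace.re = ∑ i, max (hA.eigenvalues i - s) 0 := by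
  have hs : 0 < 1 - s := sub_pos.2 hs1
  refine ⟨hA.withEigenvalues fun i => min (hA.eigenvalues i) s / s,
    hA.withEigenvalues fun i => max (hA.eigenvalues i - s) 0 / (1 - s),
    hA.isEffect_withEigenvalues (fun i => div_nonneg (le_min (h0 i) hs0.le) hs0.le)
      (fun i => div_le_one_of_le₀ (min_le_right _ _) hs0.le),
    hA.isEffect_withEigenvalues (fun i => div_nonneg (le_max_right _ _) hs.le)
      (fun i => div_le_one_of_le₀ (max_le (by linarith [h1 i]) hs.le) hs.le), ?_, ?_⟩
  · rw [← withEigenvalues_smul, ← withEigenvalues_smul, ← withEigenvalues_add]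
    conv_lhs => rw [← hA.withEigenvalues_eigenvalues]
    congr 1
    ext i
    simp only [Pi.add_apply, Pi.smul_apply, smul_eq_mul, mul_div_cancel₀ _ hs0.ne',
      mul_div_cancel₀ _ hs.ne']
    rcases le_total (hA.eigenvalues i) s with h | h
    · rw [min_eq_left h, max_eq_right (by linarith), add_zero]
    · rw [min_eq_right h, max_eq_left (by linarith)]; ring
  · rw [trace_withEigenvalues, Finset.mul_sum]
    exact Finset.sum_congr rfl fun i _ => mul_div_cancel₀ _ hs.ne'

theorem exists_spectral_projection (s : ℝ) :
    ∃ Q : Matrix n n ℂ, Q.IsHermitian ∧ Q * Q = Q ∧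
      ∑ i, max (hA.eigenvalues i - s) 0 = (Q * A).trace.re - s * Q.trace.re := by
  let q : n → ℝ := fun i => if s < hA.eigenvalues i then 1 else 0
  refine ⟨hA.withEigenvalues q, hA.isHermitian_withEigenvalues q, ?_, ?_⟩
  · rw [withEigenvalues_mul]
    congr 1
    ext i
    simp [q]
  · have h : hA.withEigenvalues q * A = hA.withEigenvalues (q * hA.eigenvalues) := by
      rw [← withEigenvalues_mul, withEigenvalues_eigenvalues]
    rw [h, trace_withEigenvalues, trace_withEigenvalues, Finset.mul_sum, ← Finset.sum_sub_distrib]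
    refine Finset.sum_congr rfl fun i _ => ?_
    by_cases hi : s < hA.eigenvalues i
    · simp [q, hi, hi.le]
    · simp [q, hi, not_lt.1 hi]

end Matrix.IsHermitian

end SpectralFun

theorem integral_hinge_div {x : ℝ} (hx0 : 0 ≤ x) (hx1 : x ≤ 1) :
    IntervalIntegrable (fun s => max (s - x) 0 / s) MeasureTheory.volume 0 1 ∧
      ∫ s in (0 : ℝ)..1, max (s - x) 0 / s = 1 - x - Real.negMulLog x := by
  have h_integrable : IntervalIntegrable (fun s => max (s - x) 0 / s) MeasureTheory.volume 0 1 := by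
    rw [intervalIntegrable_iff]
    refine MeasureTheory.Measure.integrableOn_of_bounded (M := 1) (by simp)
      (Measurable.aestronglyMeasurable (by fun_prop)) ?_
    filter_upwards [MeasureTheory.ae_restrict_mem measurableSet_uIoc] with s hs
    rw [Set.uIoc_of_le zero_le_one] at hs
    rw [Real.norm_of_nonneg (div_nonneg (le_max_right _ _) hs.1.le)]
    exact div_le_one_of_le₀ (max_le (by linarith) hs.1.le) hs.1.le
  refine ⟨h_integrable, ?_⟩
  rcases hx0.eq_or_lt with rfl | hx
  · rw [intervalIntegral.integral_congr_ae (g := fun _ => (1 : ℝ))]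
    · simp
    · refine Filter.Eventually.of_forall fun s hs => ?_
      rw [Set.uIoc_of_le zero_le_one] at hs
      rw [sub_zero, max_eq_left hs.1.le, div_self hs.1.ne']
  · have hmem : x ∈ Set.uIcc (0 : ℝ) 1 := by rw [Set.uIcc_of_le zero_le_one]; exact ⟨hx0, hx1⟩
    rw [← intervalIntegral.integral_add_adjacent_intervals (b := x)
      (h_integrable.mono_set (Set.uIcc_subset_uIcc_left hmem))
      (h_integrable.mono_set (Set.uIcc_subset_uIcc_right hmem))]
    have hleft : ∫ s in (0 : ℝ)..x, max (s - x) 0 / s = ∫ _ in (0 : ℝ)..x, (0 : ℝ) := by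
      refine intervalIntegral.integral_congr fun s hs => ?_
      rw [Set.uIcc_of_le hx0] at hs
      simp [max_eq_right (sub_nonpos.2 hs.2)]
    have hright : ∫ s in x..1, max (s - x) 0 / s = ∫ s in x..1, (1 - x * s⁻¹) := by
      refine intervalIntegral.integral_congr fun s hs => ?_
      rw [Set.uIcc_of_le hx1] at hs
      have hs0 : s ≠ 0 := (hx.trans_le hs.1).ne'
      simp only [max_eq_left (sub_nonneg.2 hs.1)]
      field_simp
    have hinv : IntervalIntegrable (fun s : ℝ => s⁻¹) MeasureTheory.volume x 1 :=
      intervalIntegrable_inv_iff.2 (Or.inr fun h => by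
        rw [Set.uIcc_of_le hx1] at h; linarith [h.1])
    rw [hleft, hright, intervalIntegral.integral_sub (by simp) (hinv.const_mul x),
      intervalIntegral.integral_const_mul, integral_inv_of_pos hx one_pos]
    simp [Real.negMulLog, Real.log_inv]

/-- Entropy sums over `[0, 1]` are determined by integrals of hinge sums. -/
theorem sum_negMulLog_eq_integral {n : Type*} [Fintype n] {t : n → ℝ} (h0 : ∀ i, 0 ≤ t i)
    (h1 : ∀ i, t i ≤ 1) :
    IntervalIntegrable (fun s => (∑ i, max (s - t i) 0) / s) MeasureTheory.volume 0 1 ∧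
      ∑ i, Real.negMulLog (t i) = Fintype.card n - ∑ i, t i
        - ∫ s in (0 : ℝ)..1, (∑ i, max (s - t i) 0) / s := by
  simp only [Finset.sum_div]
  have h i := integral_hinge_div (h0 i) (h1 i)
  refine ⟨by
    simpa [Finset.sum_fn] using IntervalIntegrable.sum Finset.univ fun i _ => (h i).1, ?_⟩
  rw [intervalIntegral.integral_finsetSum fun i _ => (h i).1]
  simp only [(h _).2, Finset.sum_sub_distrib]
  simp

theorem sum_hinge_flip {n : Type*} [Fintype n] (t : n → ℝ) (s : ℝ) :
    ∑ i, max (s - t i) 0 = ∑ i, max (t i - s) 0 + Fintype.card n * s - ∑ i, t i := by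
  have h i : max (s - t i) 0 = max (t i - s) 0 + s - t i := by
    rcases le_total s (t i) with h | h
    · rw [max_eq_right (by linarith), max_eq_left (by linarith)]; ring
    · rw [max_eq_left (by linarith), max_eq_right (by linarith)]; ring
  simp [h, Finset.sum_sub_distrib, Finset.sum_add_distrib]

theorem swapSum_mix {n : Type*} [Fintype n] (x y s : ℝ) (L U L' U' : Matrix n n ℂ) :
    swapSum x y ((s : ℂ) • L + ((1 - s : ℝ) : ℂ) • U) ((s : ℂ) • L' + ((1 - s : ℝ) : ℂ) • U')
      = ((s * s : ℝ) : ℂ) • swapSum x y L L' + ((s * (1 - s) : ℝ) : ℂ) • swapSum x y L U'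
        + (((1 - s) * s : ℝ) : ℂ) • swapSum x y U L'
        + (((1 - s) * (1 - s) : ℝ) : ℂ) • swapSum x y U U' := by
  simp only [swapSum, mul_add, add_mul, smul_mul_assoc, mul_smul_comm]
  push_cast
  module

section Hinge

variable {n : Type*} [Fintype n] [DecidableEq n] {A B : Matrix n n ℂ}

/-- The hinge sums `∑ (t - s)₊` over spectra are convex along `swapSum`. -/
theorem sum_hinge_eigenvalues_swapSum_le (hA : A.IsHermitian) (hB : B.IsHermitian)
    (hA0 : ∀ i, 0 ≤ hA.eigenvalues i) (hA1 : ∀ i, hA.eigenvalues i ≤ 1)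
    (hB0 : ∀ i, 0 ≤ hB.eigenvalues i) (hB1 : ∀ i, hB.eigenvalues i ≤ 1)
    {x y : ℝ} (hxy : x ^ 2 + y ^ 2 = 1) (hT : (swapSum x y A B).IsHermitian)
    {s : ℝ} (hs0 : 0 < s) (hs1 : s < 1) :
    ∑ i, max (hT.eigenvalues i - s) 0 ≤ x ^ 2 * ∑ i, max (hA.eigenvalues i - s) 0
      + y ^ 2 * ∑ i, max (hB.eigenvalues i - s) 0 := by
  obtain ⟨Q, hQ, hQQ, hsum⟩ := hT.exists_spectral_projection s
  obtain ⟨L, U, hL, hU, hAdec, hUtr⟩ := hA.exists_effect_decomposition hA0 hA1 hs0 hs1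
  obtain ⟨L', U', hL', hU', hBdec, hUtr'⟩ := hB.exists_effect_decomposition hB0 hB1 hs0 hs1
  have hs : 0 < 1 - s := sub_pos.2 hs1
  have hmix : (Q * swapSum x y A B).trace.re
      = s * s * (Q * swapSum x y L L').trace.re + s * (1 - s) * (Q * swapSum x y L U').trace.re
        + (1 - s) * s * (Q * swapSum x y U L').trace.re
        + (1 - s) * (1 - s) * (Q * swapSum x y U U').trace.re := by
    rw [hAdec, hBdec, swapSum_mix]
    simp only [mul_add, mul_smul_comm, trace_add, trace_smul, smul_eq_mul, Complex.add_re,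
      Complex.re_ofReal_mul]
  have hLL := mul_le_mul_of_nonneg_left
    (hL.re_trace_proj_mul_swapSum_le_rank hL' hQ hQQ hxy) (mul_pos hs0 hs0).le
  have hLU := mul_le_mul_of_nonneg_left
    (hL.re_trace_proj_mul_swapSum_le_right hU' hQ hQQ x y) (mul_pos hs0 hs).le
  have hUL := mul_le_mul_of_nonneg_left
    (hU.re_trace_proj_mul_swapSum_le_left hL' hQ hQQ x y) (mul_pos hs hs0).le
  have hUU := mul_le_mul_of_nonneg_left
    (hU.re_trace_proj_mul_swapSum_le_traces hU' hQ hQQ x y) (mul_pos hs hs).le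
  rw [hsum, hmix, ← hUtr, ← hUtr']
  have hy : y ^ 2 = 1 - x ^ 2 := by linarith
  rw [hy] at hLU hUL hUU ⊢
  linarith

theorem Matrix.PosSemidef.eigenvalues_le_one (hA : A.PosSemidef) (htr : A.trace.re = 1) (i : n) :
    hA.isHermitian.eigenvalues i ≤ 1 := by
  rw [← hA.isHermitian.withEigenvalues_eigenvalues, IsHermitian.trace_withEigenvalues] at htr
  rw [← htr]
  exact Finset.single_le_sum (fun j _ => hA.eigenvalues_nonneg j) (Finset.mem_univ i)

theorem Matrix.PosSemidef.isEffect (hA : A.PosSemidef) (htr : A.trace.re = 1) : IsEffect A := by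
  rw [← hA.isHermitian.withEigenvalues_eigenvalues]
  exact hA.isHermitian.isEffect_withEigenvalues hA.eigenvalues_nonneg (hA.eigenvalues_le_one htr)

theorem sum_eigenvalues_eq_one (hA : A.IsHermitian) (htr : A.trace.re = 1) :
    ∑ i, hA.eigenvalues i = 1 := by
  rw [← hA.trace_withEigenvalues, hA.withEigenvalues_eigenvalues, htr]

end Hinge

theorem vnEntropy_eq {d : ℕ} {ρ : Matrix (Fin d) (Fin d) ℂ} (h : ρ.IsHermitian) :
    vnEntropy ρ = ∑ i, Real.negMulLog (h.eigenvalues i) :=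
  dif_pos h

theorem boxplus_eq_swapSum {d : ℕ} {α : ℝ} (h0 : 0 ≤ α) (h1 : α ≤ 1)
    (ρ σ : Matrix (Fin d) (Fin d) ℂ) :
    boxplus α ρ σ = swapSum (Real.sqrt α) (Real.sqrt (1 - α)) ρ σ := by
  rw [boxplus, swapSum, Real.sqrt_mul h0, Complex.ofReal_mul, ← Complex.ofReal_pow,
    ← Complex.ofReal_pow, Real.sq_sqrt h0, Real.sq_sqrt (sub_nonneg.2 h1)]

theorem stmt_8 (d : ℕ) (α : ℝ) (hα : α ∈ Set.Icc (0:ℝ) 1)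
    (ρ σ : Matrix (Fin d) (Fin d) ℂ)
    (hρ : ρ.PosSemidef) (hρtr : ρ.trace = 1)
    (hσ : σ.PosSemidef) (hσtr : σ.trace = 1) :
    vnEntropy (boxplus α ρ σ) ≥ α * vnEntropy ρ + (1 - α) * vnEntropy σ := by
  obtain ⟨hα0, hα1⟩ := hα
  have hx : Real.sqrt α ^ 2 = α := Real.sq_sqrt hα0
  have hy : Real.sqrt (1 - α) ^ 2 = 1 - α := Real.sq_sqrt (sub_nonneg.2 hα1)
  have hρtr' : ρ.trace.re = 1 := by rw [hρtr, Complex.one_re]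
  have hσtr' : σ.trace.re = 1 := by rw [hσtr, Complex.one_re]
  rw [boxplus_eq_swapSum hα0 hα1]
  set x := Real.sqrt α
  set y := Real.sqrt (1 - α)
  have hxy : x ^ 2 + y ^ 2 = 1 := by rw [hx, hy]; ring
  have hτ := (hρ.isEffect hρtr').swapSum_posSemidef (hσ.isEffect hσtr') x y
  have hτtr : (swapSum x y ρ σ).trace.re = 1 := by
    rw [re_trace_swapSum, hρtr', hσtr', mul_one, mul_one, hxy]
  obtain ⟨hρint, hρent⟩ :=
    sum_negMulLog_eq_integral hρ.eigenvalues_nonneg (hρ.eigenvalues_le_one hρtr')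
  obtain ⟨hσint, hσent⟩ :=
    sum_negMulLog_eq_integral hσ.eigenvalues_nonneg (hσ.eigenvalues_le_one hσtr')
  obtain ⟨hτint, hτent⟩ :=
    sum_negMulLog_eq_integral hτ.eigenvalues_nonneg (hτ.eigenvalues_le_one hτtr)
  rw [vnEntropy_eq hρ.isHermitian, vnEntropy_eq hσ.isHermitian, vnEntropy_eq hτ.isHermitian,
    hρent, hσent, hτent]
  have hρsum := sum_eigenvalues_eq_one hρ.isHermitian hρtr'
  have hσsum := sum_eigenvalues_eq_one hσ.isHermitian hσtr'
  have hτsum := sum_eigenvalues_eq_one hτ.isHermitian hτtr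
  have hmono := intervalIntegral.integral_mono_on_of_le_Ioo zero_le_one hτint
    ((hρint.const_mul α).add (hσint.const_mul (1 - α))) fun s hs => by
      have h := sum_hinge_eigenvalues_swapSum_le hρ.isHermitian hσ.isHermitian
        hρ.eigenvalues_nonneg (hρ.eigenvalues_le_one hρtr') hσ.eigenvalues_nonneg
        (hσ.eigenvalues_le_one hσtr') hxy hτ.isHermitian hs.1 hs.2
      rw [hx, hy] at h
      simp only [sum_hinge_flip, hρsum, hσsum, hτsum]
      rw [← mul_div_assoc, ← mul_div_assoc, ← add_div]
      refine div_le_div_of_nonneg_right ?_ hs.1.le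
      linarith
  rw [intervalIntegral.integral_add (hρint.const_mul α) (hσint.const_mul (1 - α)),
    intervalIntegral.integral_const_mul, intervalIntegral.integral_const_mul] at hmono
  rw [hρsum, hσsum, hτsum]
  linarith
end

section
/- The entropy power EP_c(ρ) := exp(c·H(ρ)) is a concave function of the density matrix ρ on ℂ^d whenever 0 ≤ c ≤ 1/(log d)². -/
open Matrix
open scoped ComplexOrder

/-! ### A bound on the variance of the surprisal -/

/-- Equivalently, `y ≤ log 2 * cosh y` for all real `y`. -/
lemma log_le_log_two_mul_add_inv {t : ℝ} (ht : 0 < t) :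
    Real.log t ≤ Real.log 2 / 2 * (t + t⁻¹) := by
  have hlow := Real.log_two_gt_d9
  have hupp := Real.log_two_lt_d9
  have hlog : Real.log t = 2 * Real.log 2 + Real.log (4 / 5) + Real.log (t / (16 / 5)) := by
    have h4 : Real.log 4 = 2 * Real.log 2 := by
      rw [show (4 : ℝ) = 2 ^ 2 by norm_num, Real.log_pow]; norm_num
    rw [← h4, ← Real.log_mul (by norm_num) (by norm_num),
      ← Real.log_mul (by norm_num) (by positivity)]
    congr 1
    ring
  have h1 : Real.log (4 / 5) ≤ 4 / 5 - 1 := Real.log_le_sub_one_of_pos (by norm_num)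
  have h2 : Real.log (t / (16 / 5)) ≤ t / (16 / 5) - 1 := Real.log_le_sub_one_of_pos (by positivity)
  have h3 : 5 / 8 - 25 / 256 * t ≤ t⁻¹ := by
    rw [inv_eq_one_div, le_div_iff₀ ht]
    nlinarith [sq_nonneg (5 * t - 16)]
  have h4 : Real.log 2 / 2 * (5 / 8 - 25 / 256 * t + t) ≤ Real.log 2 / 2 * (t + t⁻¹) := by
    apply mul_le_mul_of_nonneg_left <;> linarith
  nlinarith

lemma mul_log_sub_log_sq_le {x y : ℝ} (hx : 0 < x) (hy : 0 < y) (hxy : x + y = 1) :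
    x * y * (Real.log x - Real.log y) ^ 2 ≤ Real.log 2 ^ 2 := by
  have key : ∀ a b : ℝ, 0 < a → 0 < b →
      2 * (a * b) * (Real.log a - Real.log b) ≤ Real.log 2 * (a ^ 2 + b ^ 2) := by
    intro a b ha hb
    have h := log_le_log_two_mul_add_inv (div_pos ha hb)
    rw [Real.log_div ha.ne' hb.ne'] at h
    calc 2 * (a * b) * (Real.log a - Real.log b)
        ≤ 2 * (a * b) * (Real.log 2 / 2 * (a / b + (a / b)⁻¹)) :=
          mul_le_mul_of_nonneg_left h (by positivity)
      _ = Real.log 2 * (a ^ 2 + b ^ 2) := by field_simp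
  have ha := Real.sqrt_pos.2 hx
  have hb := Real.sqrt_pos.2 hy
  have h1 := key _ _ ha hb
  have h2 := key _ _ hb ha
  rw [Real.sq_sqrt hx.le, Real.sq_sqrt hy.le, Real.log_sqrt hx.le, Real.log_sqrt hy.le] at h1 h2
  have h3 : (√x * √y * (Real.log x - Real.log y)) ^ 2 ≤ Real.log 2 ^ 2 := by
    apply sq_le_sq'
    · rw [add_comm, hxy] at h2
      linarith
    · rw [hxy] at h1
      linarith
  rwa [mul_pow, mul_pow, Real.sq_sqrt hx.le, Real.sq_sqrt hy.le] at h3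

lemma sq_add_mul_le_exp {m s : ℝ} (hm : 0.549 ≤ m) (hs : 0 ≤ s) :
    s ^ 2 + 2 * m * s ≤ 3 * m ^ 2 * Real.exp s := by
  have hexp : 1 + s + s ^ 2 / 2 + s ^ 3 / 6 + s ^ 4 / 24 + s ^ 5 / 120 ≤ Real.exp s := by
    have h := Real.sum_le_exp_of_nonneg hs 6
    norm_num [Finset.sum_range_succ, Nat.factorial] at h
    exact h
  have hpoly : s ^ 2 + 2 * 0.549 * s ≤
      3 * 0.549 ^ 2 * (1 + s + s ^ 2 / 2 + s ^ 3 / 6 + s ^ 4 / 24 + s ^ 5 / 120) := by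
    have hsq := sq_nonneg (s - 1.65)
    nlinarith [mul_nonneg hs hsq, mul_nonneg (pow_nonneg hs 2) hsq,
      mul_nonneg (pow_nonneg hs 3) hsq]
  set E := Real.exp s
  have hE : s ≤ 3 * 0.549 * E := by nlinarith [Real.add_one_le_exp s]
  have h0 : s ^ 2 + 2 * 0.549 * s ≤ 3 * 0.549 ^ 2 * E := by nlinarith
  nlinarith [mul_nonneg (sub_nonneg.2 hm) (sub_nonneg.2 hE),
    mul_nonneg (mul_nonneg (sub_nonneg.2 hm) (sub_nonneg.2 hm)) (Real.exp_pos s).le]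

lemma mul_log_add_sq_le {m x : ℝ} (hm : 0.549 ≤ m) (hx0 : 0 ≤ x) (hx1 : x ≤ 1) :
    x * (Real.log x + m) ^ 2 ≤ 3 * m ^ 2 * Real.exp (-(2 * m)) + m ^ 2 * x := by
  rcases hx0.eq_or_lt with rfl | hx
  · simp; positivity
  have hlog : Real.log x ≤ 0 := Real.log_nonpos hx0 hx1
  rcases le_total (-(2 * m)) (Real.log x) with h | h
  · have h1 : (Real.log x + m) ^ 2 ≤ m ^ 2 := by apply sq_le_sq' <;> linarith
    have h2 : 0 ≤ 3 * m ^ 2 * Real.exp (-(2 * m)) := by positivity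
    nlinarith
  · have h1 := sq_add_mul_le_exp hm (s := -(2 * m) - Real.log x) (by linarith)
    have h2 : x * Real.exp (-(2 * m) - Real.log x) = Real.exp (-(2 * m)) := by
      rw [Real.exp_sub, Real.exp_log hx]
      field_simp
    have h3 := mul_le_mul_of_nonneg_left h1 hx0
    rw [← h2]
    linarith

/-- The variance of `log p` under a distribution `p` on `d` points is at most `(log d) ^ 2`. -/
lemma exists_sum_mul_log_add_sq_le {d : ℕ} (hd : 2 ≤ d) (q : Fin d → ℝ) (hq : ∀ i, 0 ≤ q i)
    (hsum : ∑ i, q i = 1) :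
    ∃ m : ℝ, ∑ i, q i * (Real.log (q i) + m) ^ 2 ≤ Real.log d ^ 2 := by
  rcases hd.eq_or_lt with rfl | hd3
  · rw [Fin.sum_univ_two] at hsum
    refine ⟨-(q 0 * Real.log (q 0) + q 1 * Real.log (q 1)), ?_⟩
    rw [Fin.sum_univ_two]
    have hq1 : q 1 = 1 - q 0 := by linarith
    have h : q 0 * q 1 * (Real.log (q 0) - Real.log (q 1)) ^ 2 ≤ Real.log 2 ^ 2 := by
      rcases (hq 0).eq_or_lt with h0 | h0
      · rw [← h0]; simp; positivity
      rcases (hq 1).eq_or_lt with h1 | h1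
      · rw [← h1]; simp; positivity
      exact mul_log_sub_log_sq_le h0 h1 hsum
    refine le_trans (le_of_eq ?_) h
    generalize Real.log (q 0) = a
    generalize Real.log (q 1) = b
    rw [hq1]
    ring
  · have hd0 : (0 : ℝ) < d := by positivity
    have hm : 0.549 ≤ Real.log d / 2 := by
      have h3 : Real.log 3 ≤ Real.log d :=
        Real.log_le_log (by norm_num) (by exact_mod_cast hd3)
      linarith [Real.log_three_gt_d9]
    have hq1 : ∀ i, q i ≤ 1 := fun i ↦
      hsum ▸ Finset.single_le_sum (fun j _ ↦ hq j) (Finset.mem_univ i)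
    refine ⟨Real.log d / 2, ?_⟩
    calc ∑ i, q i * (Real.log (q i) + Real.log d / 2) ^ 2
        ≤ ∑ i, (3 * (Real.log d / 2) ^ 2 * Real.exp (-(2 * (Real.log d / 2)))
            + (Real.log d / 2) ^ 2 * q i) :=
          Finset.sum_le_sum fun i _ ↦ mul_log_add_sq_le hm (hq i) (hq1 i)
      _ = Real.log d ^ 2 := by
          rw [Finset.sum_add_distrib, ← Finset.mul_sum Finset.univ q, hsum, mul_div_cancel₀ _ two_ne_zero,
            Real.exp_neg, Real.exp_log hd0]
          simp only [Finset.sum_const, Finset.card_univ, Fintype.card_fin, nsmul_eq_mul]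
          field_simp
          norm_num

/-! ### The commutative case -/

lemma mul_sum_mul_log_sq_le {d : ℕ} (hd : 2 ≤ d) {c : ℝ}
    (hc : c ≤ 1 / Real.log d ^ 2) (q v : Fin d → ℝ) (hq : ∀ i, 0 ≤ q i) (hsum : ∑ i, q i = 1)
    (hv : ∑ i, v i = 0) (hqv : ∀ i, q i = 0 → v i = 0) :
    c * (∑ i, v i * (-Real.log (q i) - 1)) ^ 2 ≤ ∑ i, v i ^ 2 / q i := by
  obtain ⟨m, hm⟩ := exists_sum_mul_log_add_sq_le hd q hq hsum
  have hlog : 0 < Real.log d := Real.log_pos (by exact_mod_cast hd)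
  have hcs : (∑ i, v i * (Real.log (q i) + m)) ^ 2
      ≤ (∑ i, v i ^ 2 / q i) * ∑ i, q i * (Real.log (q i) + m) ^ 2 := by
    apply Finset.sum_sq_le_sum_mul_sum_of_sq_le_mul
    · exact fun i _ ↦ div_nonneg (sq_nonneg _) (hq i)
    · exact fun i _ ↦ mul_nonneg (hq i) (sq_nonneg _)
    · intro i _
      rcases eq_or_ne (q i) 0 with h | h
      · simp [h, hqv i h]
      · apply le_of_eq
        field_simp
  have hshift : ∑ i, v i * (-Real.log (q i) - 1) = -∑ i, v i * (Real.log (q i) + m) := by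
    have h : ∀ i, v i * (-Real.log (q i) - 1)
        = -(v i * (Real.log (q i) + m)) + (m - 1) * v i := fun i ↦ by ring
    simp only [h, Finset.sum_add_distrib, Finset.sum_neg_distrib, ← Finset.mul_sum, hv]
    ring
  have hF : 0 ≤ ∑ i, v i ^ 2 / q i :=
    Finset.sum_nonneg fun i _ ↦ div_nonneg (sq_nonneg _) (hq i)
  rw [hshift, neg_sq]
  calc c * (∑ i, v i * (Real.log (q i) + m)) ^ 2
      ≤ 1 / Real.log d ^ 2 * ((∑ i, v i ^ 2 / q i) * Real.log d ^ 2) :=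
        mul_le_mul hc (hcs.trans (mul_le_mul_of_nonneg_left hm hF)) (sq_nonneg _) (by positivity)
    _ = ∑ i, v i ^ 2 / q i := by field_simp

/-- Concavity of the entropy power of a probability distribution on `d` points. -/
lemma concaveOn_exp_mul_sum_negMulLog {d : ℕ} (hd : 2 ≤ d) {c : ℝ} (hc0 : 0 ≤ c)
    (hc : c ≤ 1 / Real.log d ^ 2) :
    ConcaveOn ℝ (stdSimplex ℝ (Fin d)) fun q ↦ Real.exp (c * ∑ i, Real.negMulLog (q i)) := by
  refine ⟨convex_stdSimplex ℝ _, fun P hP Q hQ a b ha hb hab ↦ ?_⟩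
  set q : ℝ → Fin d → ℝ := fun s i ↦ P i + s * (Q i - P i) with hqdef
  have hqd : ∀ s i, HasDerivAt (fun s ↦ q s i) (Q i - P i) s := fun s i ↦ by
    simpa only [one_mul, id] using ((hasDerivAt_id s).mul_const (Q i - P i)).const_add (P i)
  have hzero : ∀ s ∈ Set.Ioo (0 : ℝ) 1, ∀ i, 0 < q s i ∨ (P i = 0 ∧ Q i = 0) := by
    intro s hs i
    have hs0 : 0 < 1 - s := sub_pos.2 hs.2
    have hform : q s i = (1 - s) * P i + s * Q i := by simp only [hqdef]; ring
    rcases (hP.1 i).eq_or_lt with h | h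
    · rcases (hQ.1 i).eq_or_lt with h' | h'
      · exact Or.inr ⟨h.symm, h'.symm⟩
      · exact Or.inl (hform ▸ by nlinarith [mul_pos hs.1 h', hP.1 i])
    · exact Or.inl (hform ▸ by nlinarith [mul_pos hs0 h, mul_nonneg hs.1.le (hQ.1 i)])
  have hconc : ConcaveOn ℝ (Set.Icc (0 : ℝ) 1)
      fun s ↦ Real.exp (c * ∑ i, Real.negMulLog (q s i)) := by
    have hH : ∀ s ∈ Set.Ioo (0 : ℝ) 1, HasDerivAt (fun s ↦ c * ∑ i, Real.negMulLog (q s i))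
        (c * ∑ i, (Q i - P i) * (-Real.log (q s i) - 1)) s := by
      intro s hs
      refine (HasDerivAt.fun_sum fun i _ ↦ ?_).const_mul c
      rcases hzero s hs i with h | ⟨h, h'⟩
      · rw [mul_comm]
        exact (Real.hasDerivAt_negMulLog h.ne').comp s (hqd s i)
      · simpa [hqdef, h, h'] using hasDerivAt_const s (0 : ℝ)
    have hH' : ∀ s ∈ Set.Ioo (0 : ℝ) 1,
        HasDerivAt (fun s ↦ c * ∑ i, (Q i - P i) * (-Real.log (q s i) - 1))
          (c * -∑ i, (Q i - P i) ^ 2 / q s i) s := by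
      intro s hs
      rw [← Finset.sum_neg_distrib]
      refine (HasDerivAt.fun_sum fun i _ ↦ ?_).const_mul c
      rcases hzero s hs i with h | ⟨h, h'⟩
      · rw [sq, mul_div_assoc, ← mul_neg]
        exact ((((hqd s i).log h.ne').neg).sub_const 1).const_mul (Q i - P i)
      · simpa [hqdef, h, h'] using hasDerivAt_const s (0 : ℝ)
    refine concaveOn_of_hasDerivWithinAt2_nonpos (convex_Icc 0 1)
      (f' := fun s ↦ Real.exp (c * ∑ i, Real.negMulLog (q s i))
        * (c * ∑ i, (Q i - P i) * (-Real.log (q s i) - 1)))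
      (f'' := fun s ↦ Real.exp (c * ∑ i, Real.negMulLog (q s i))
        * (c * ∑ i, (Q i - P i) * (-Real.log (q s i) - 1))
        * (c * ∑ i, (Q i - P i) * (-Real.log (q s i) - 1))
        + Real.exp (c * ∑ i, Real.negMulLog (q s i)) * (c * -∑ i, (Q i - P i) ^ 2 / q s i))
      ?_ ?_ ?_ ?_
    · have : ∀ i, Continuous fun s ↦ q s i := fun i ↦ by simp only [hqdef]; fun_prop
      fun_prop
    all_goals
      rw [interior_Icc]
      intro s hs
    · exact (hH s hs).exp.hasDerivWithinAt
    · exact ((hH s hs).exp.mul (hH' s hs)).hasDerivWithinAt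
    · have hv : ∑ i, (Q i - P i) = 0 := by rw [Finset.sum_sub_distrib, hP.2, hQ.2, sub_self]
      have hbound := mul_sum_mul_log_sq_le hd hc (q s) (fun i ↦ Q i - P i)
        (fun i ↦ by
          rcases hzero s hs i with h | ⟨h, h'⟩
          · exact h.le
          · simp [hqdef, h, h'])
        (by simp only [hqdef, Finset.sum_add_distrib, ← Finset.mul_sum, hv, hP.2]; simp) hv
        (fun i hi ↦ by
          rcases hzero s hs i with h | ⟨h, h'⟩
          · exact absurd hi h.ne'
          · simp [h, h'])
      have := mul_nonneg (mul_nonneg (Real.exp_pos (c * ∑ i, Real.negMulLog (q s i))).le hc0)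
        (sub_nonneg.2 hbound)
      linarith
  have h := hconc.2 (Set.left_mem_Icc.2 zero_le_one) (Set.right_mem_Icc.2 zero_le_one) ha hb hab
  have hmix : ∀ i, q b i = (a • P + b • Q) i := fun i ↦ by
    simp only [hqdef, Pi.add_apply, Pi.smul_apply, smul_eq_mul]
    rw [eq_sub_iff_add_eq.2 hab]
    ring
  simpa [hqdef, ← hmix] using h

/-! ### Reduction to the diagonal -/

/-- The diagonal of `A` in the orthonormal basis given by the columns of `U`. -/
noncomputable def diagIn {d : ℕ} (U A : Matrix (Fin d) (Fin d) ℂ) (i : Fin d) : ℝ :=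
  ((star U * A * U) i i).re

lemma diagIn_mem_stdSimplex {d : ℕ} (U : unitaryGroup (Fin d) ℂ) {A : Matrix (Fin d) (Fin d) ℂ}
    (hA : A.PosSemidef) (htr : A.trace = 1) :
    diagIn (U : Matrix (Fin d) (Fin d) ℂ) A ∈ stdSimplex ℝ (Fin d) := by
  constructor
  · intro i
    exact (Complex.le_def.1
      (hA.conjTranspose_mul_mul_same (U : Matrix (Fin d) (Fin d) ℂ)).diag_nonneg).1
  · have h : (star (U : Matrix (Fin d) (Fin d) ℂ) * A * U).trace = 1 := by
      rw [Matrix.trace_mul_cycle, ← htr]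
      simp
    simpa [Matrix.trace, diagIn] using congrArg Complex.re h

lemma diagIn_eigenvectorUnitary {d : ℕ} {A : Matrix (Fin d) (Fin d) ℂ} (hA : A.IsHermitian) :
    diagIn (hA.eigenvectorUnitary : Matrix (Fin d) (Fin d) ℂ) A = hA.eigenvalues := by
  funext i
  have h := hA.conjStarAlgAut_star_eigenvectorUnitary
  rw [Unitary.conjStarAlgAut_star_apply] at h
  simp [diagIn, h]

/-- Passing to the diagonal in an orthonormal basis does not decrease the entropy. -/
lemma vnEntropy_le_sum_negMulLog_diagIn {d : ℕ} (U : unitaryGroup (Fin d) ℂ)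
    {A : Matrix (Fin d) (Fin d) ℂ} (hA : A.PosSemidef) :
    vnEntropy A ≤ ∑ i, Real.negMulLog (diagIn (U : Matrix (Fin d) (Fin d) ℂ) A i) := by
  have hH := hA.isHermitian
  rw [vnEntropy, dif_pos hH]
  set X : unitaryGroup (Fin d) ℂ := star U * hH.eigenvectorUnitary with hX
  have hrow : ∀ i, ∑ j, Complex.normSq (X.1 i j) = 1 := fun i ↦ by
    have h := congrArg Complex.re (congrFun (congrFun (Unitary.coe_mul_star_self X) i) i)
    simpa [Matrix.mul_apply, Matrix.star_apply, Complex.mul_conj] using h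
  have hcol : ∀ j, ∑ i, Complex.normSq (X.1 i j) = 1 := fun j ↦ by
    have h := congrArg Complex.re (congrFun (congrFun (Unitary.coe_star_mul_self X) j) j)
    simpa [Matrix.mul_apply, Matrix.star_apply, ← Complex.normSq_eq_conj_mul_self] using h
  have hdiag : ∀ i, diagIn (U : Matrix (Fin d) (Fin d) ℂ) A i
      = ∑ j, Complex.normSq (X.1 i j) • hH.eigenvalues j := fun i ↦ by
    have h : star U.1 * A * U.1 = X.1 * diagonal (RCLike.ofReal ∘ hH.eigenvalues) * star X.1 := by
      conv_lhs => rw [hH.spectral_theorem, Unitary.conjStarAlgAut_apply]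
      simp [hX, mul_assoc]
    rw [diagIn, h, Matrix.mul_apply, Complex.re_sum]
    refine Finset.sum_congr rfl fun j _ ↦ ?_
    simp [Matrix.mul_diagonal, Matrix.star_apply, Complex.normSq_apply]
    ring
  calc ∑ j, Real.negMulLog (hH.eigenvalues j)
      = ∑ i, ∑ j, Complex.normSq (X.1 i j) • Real.negMulLog (hH.eigenvalues j) := by
        rw [Finset.sum_comm]
        simp only [← Finset.sum_smul, hcol, one_smul]
    _ ≤ ∑ i, Real.negMulLog (diagIn (U : Matrix (Fin d) (Fin d) ℂ) A i) := by
        refine Finset.sum_le_sum fun i _ ↦ ?_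
        rw [hdiag]
        exact Real.concaveOn_negMulLog.le_map_sum (fun j _ ↦ Complex.normSq_nonneg _) (hrow i)
          fun j _ ↦ hA.eigenvalues_nonneg j

theorem stmt_13 (d : ℕ) (hd : 2 ≤ d) (c : ℝ)
    (hc : 0 ≤ c ∧ c ≤ 1 / (Real.log d) ^ 2)
    (ρ σ : Matrix (Fin d) (Fin d) ℂ)
    (hρ : ρ.PosSemidef) (hρtr : ρ.trace = 1)
    (hσ : σ.PosSemidef) (hσtr : σ.trace = 1)
    (p : ℝ) (hp : p ∈ Set.Icc (0:ℝ) 1) :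
    Real.exp (c * vnEntropy ((p : ℂ) • ρ + ((1 - p : ℝ) : ℂ) • σ))
      ≥ p * Real.exp (c * vnEntropy ρ) + (1 - p) * Real.exp (c * vnEntropy σ) := by
  have hp1 : 0 ≤ 1 - p := sub_nonneg.2 hp.2
  have hτ : ((p : ℂ) • ρ + ((1 - p : ℝ) : ℂ) • σ).IsHermitian :=
    ((hρ.smul (Complex.zero_le_real.2 hp.1)).add (hσ.smul (Complex.zero_le_real.2 hp1))).isHermitian
  set U := hτ.eigenvectorUnitary with hU
  have hlin : hτ.eigenvalues = p • diagIn (U : Matrix (Fin d) (Fin d) ℂ) ρ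
      + (1 - p) • diagIn (U : Matrix (Fin d) (Fin d) ℂ) σ := by
    rw [← diagIn_eigenvectorUnitary hτ]
    funext i
    simp only [diagIn, Matrix.mul_add, Matrix.add_mul, Matrix.mul_smul, Matrix.smul_mul,
      Matrix.add_apply, Matrix.smul_apply, smul_eq_mul, Complex.add_re, Complex.re_ofReal_mul,
      Pi.add_apply, Pi.smul_apply, hU]
  have hmono : ∀ {A : Matrix (Fin d) (Fin d) ℂ}, A.PosSemidef → Real.exp (c * vnEntropy A)
      ≤ Real.exp (c * ∑ i, Real.negMulLog (diagIn (U : Matrix (Fin d) (Fin d) ℂ) A i)) :=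
    fun hA ↦ Real.exp_le_exp.2
      (mul_le_mul_of_nonneg_left (vnEntropy_le_sum_negMulLog_diagIn U hA) hc.1)
  have hconc := (concaveOn_exp_mul_sum_negMulLog hd hc.1 hc.2).2
    (diagIn_mem_stdSimplex U hρ hρtr) (diagIn_mem_stdSimplex U hσ hσtr) hp.1 hp1 (by ring)
  rw [← hlin] at hconc
  conv_lhs => rw [vnEntropy, dif_pos hτ]
  exact (add_le_add (mul_le_mul_of_nonneg_left (hmono hρ) hp.1)
    (mul_le_mul_of_nonneg_left (hmono hσ) hp1)).trans hconc
end
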